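/- Let e ≥ 2, s ∈ ℤ^l and λ an l-partition such that B(λ,s) is semistandard and (λ,s) is e-periodic. Then B(λ⁻,s⁻), the symbol obtained by deleting the e-period of B(λ,s), is again semistandard. Consequently all the symbols appearing during the peeling procedure applied to a semistandard symbol remain semistandard. -/

import Mathlib

/- Formalization of combinatorial notions from
   "A combinatorial decomposition of higher level Fock spaces"
   by N. Jacon and C. Lecouvey. -/

open scoped Classical

noncomputable section

namespace FockHW

/-- An `l`-partition, encoded by `P c i = λ^c_{i+1}` (`i` is the 0-based row index). -/
abbrev MP (l : ℕ) := Fin l → ℕ → ℕ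

/-- A multicharge `s ∈ ℤ^l`. -/
abbrev Charge (l : ℕ) := Fin l → ℤ

/-- `P` is a genuine `l`-partition: each component is a weakly decreasing,
eventually zero, sequence of nonnegative integers. -/
def IsLPartition {l : ℕ} (P : MP l) : Prop :=
  (∀ c, Antitone (P c)) ∧ ∀ c, ∃ N, ∀ i, N ≤ i → P c i = 0

/-- The empty `l`-partition. -/
def emptyMP (l : ℕ) : MP l := fun _ _ => 0

/-- The entry `B(λ,s)^c_{i+1} = λ^c_{i+1} - (i+1) + s_c + 1` of the symbol of `(λ,s)`. -/
def symb {l : ℕ} (P : MP l) (s : Charge l) (c : Fin l) (i : ℕ) : ℤ :=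
  (P c i : ℤ) - (i : ℤ) + s c

/-- `v` is an entry of the `c`-th row of the symbol of `(P,s)`. -/
def RowHas {l : ℕ} (P : MP l) (s : Charge l) (c : Fin l) (v : ℤ) : Prop :=
  ∃ i, symb P s c i = v

/-- `k` is the largest entry of the symbol of `(P,s)`. -/
def IsMaxEntry {l : ℕ} (P : MP l) (s : Charge l) (k : ℤ) : Prop :=
  (∃ c, RowHas P s c k) ∧ ∀ c v, RowHas P s c v → v ≤ k

/-- The data `(k, per)` is an `e`-period of the symbol of `(P,s)`:
`k` is the largest entry, the rows `per 0 ≥ per 1 ≥ …` carry the entries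
`k, k-1, …, k-e+1`, and no entry `k-t` occurs in a row strictly below `per t`. -/
def IsEPeriod {l : ℕ} (e : ℕ) (P : MP l) (s : Charge l) (k : ℤ) (per : Fin e → Fin l) : Prop :=
  IsMaxEntry P s k ∧ Antitone per ∧
  ∀ t : Fin e, RowHas P s (per t) (k - ((t : ℕ) : ℤ)) ∧
    ∀ d : Fin l, RowHas P s d (k - ((t : ℕ) : ℤ)) → per t ≤ d

/-- `(P,s)` is `e`-periodic. -/
def EPeriodic {l : ℕ} (e : ℕ) (P : MP l) (s : Charge l) : Prop :=
  ∃ k per, IsEPeriod e P s k per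

/-- `(P',s')` is obtained from `(P,s)` by deleting the `e`-period with data `(k, per)`:
rowwise, the entries of the new symbol are the old ones minus the period entries. -/
def DeletesToWith {l : ℕ} (e : ℕ) (P : MP l) (s : Charge l) (k : ℤ) (per : Fin e → Fin l)
    (P' : MP l) (s' : Charge l) : Prop :=
  IsEPeriod e P s k per ∧ IsLPartition P' ∧
  ∀ d : Fin l, {v : ℤ | RowHas P' s' d v} =
    {v : ℤ | RowHas P s d v} \ {v : ℤ | ∃ t : Fin e, per t = d ∧ v = k - ((t : ℕ) : ℤ)}

/-- `(P',s')` is obtained from `(P,s)` by deleting the `e`-period. -/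
def DeletesTo {l : ℕ} (e : ℕ) (P : MP l) (s : Charge l) (P' : MP l) (s' : Charge l) : Prop :=
  ∃ k per, DeletesToWith e P s k per P' s'

/-- One step of the map `(λ,s) ↦ (λ⁻,s⁻)`: delete the `e`-period if `(λ,s)` is
`e`-periodic, do nothing otherwise. -/
def DeleteStep {l : ℕ} (e : ℕ) (P : MP l) (s : Charge l) (P' : MP l) (s' : Charge l) : Prop :=
  (¬ EPeriodic e P s ∧ P' = P ∧ s' = s) ∨ DeletesTo e P s P' s'

/-- The set `T_{l,e}` of weakly increasing multicharges with spread at most `e-1`. -/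
def Tle (l e : ℕ) : Set (Charge l) :=
  {t | Monotone t ∧ ∀ c d : Fin l, t d - t c ≤ (e : ℤ) - 1}

/-- The peeling procedure applied to `(P,s)` terminates at `(∅,t)`:
there is a chain of `e`-period deletions from `(P,s)` to `(∅,t)` with `t ∈ T_{l,e}`,
not passing through any `(∅,t')` with `t' ∈ T_{l,e}` earlier (so `λ° = ∅`, `s° = t`). -/
def PeelChainTo {l : ℕ} (e : ℕ) (P : MP l) (s : Charge l) (t : Charge l) : Prop :=
  t ∈ Tle l e ∧ ∃ (n : ℕ) (g : ℕ → MP l × Charge l), g 0 = (P, s) ∧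
    (∀ m, m < n → ¬((g m).1 = emptyMP l ∧ (g m).2 ∈ Tle l e) ∧
      DeletesTo e (g m).1 (g m).2 (g (m+1)).1 (g (m+1)).2) ∧
    g n = (emptyMP l, t)

/-- `(P,s)` is totally periodic: the peeling procedure ends with the empty
`l`-partition and a multicharge in `T_{l,e}`. -/
def TotallyPeriodic {l : ℕ} (e : ℕ) (P : MP l) (s : Charge l) : Prop :=
  ∃ t, PeelChainTo e P s t

/-- Indicator (valued in `ℤ`) of an addable node of content `x` in component `c`. -/
def addA {l : ℕ} (P : MP l) (s : Charge l) (c : Fin l) (x : ℤ) : ℤ :=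
  if RowHas P s c x ∧ ¬ RowHas P s c (x + 1) then 1 else 0

/-- Indicator (valued in `ℤ`) of a removable node of content `x` in component `c`. -/
def remR {l : ℕ} (P : MP l) (s : Charge l) (c : Fin l) (x : ℤ) : ℤ :=
  if RowHas P s c (x + 1) ∧ ¬ RowHas P s c x then 1 else 0

/-- `#R - #A` on the suffix of the `j`-word (`e = ∞`) starting at the node of
content `j` in component `c0` (the `j`-word is ordered by decreasing component). -/
def suffInf {l : ℕ} (P : MP l) (s : Charge l) (j : ℤ) (c0 : Fin l) : ℤ :=
  ∑ c ∈ Finset.univ.filter (fun c : Fin l => c ≤ c0), (remR P s c j - addA P s c j)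

/-- `#A - #R` on the prefix of the `j`-word (`e = ∞`) ending at the node of
content `j` in component `c0`. -/
def prefInf {l : ℕ} (P : MP l) (s : Charge l) (j : ℤ) (c0 : Fin l) : ℤ :=
  ∑ c ∈ Finset.univ.filter (fun c : Fin l => c0 ≤ c), (addA P s c j - remR P s c j)

/-- `ε^∞_j(λ)`: the number of `R`'s in the reduced `j`-word of `λ` (`e = ∞`),
computed as the largest value of `#R - #A` over suffixes of the `j`-word. -/
def epsInf {l : ℕ} (P : MP l) (s : Charge l) (j : ℤ) : ℤ :=
  sSup (insert 0 {z : ℤ | ∃ c0, z = suffInf P s j c0})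

/-- `φ^∞_j(λ)`: the number of `A`'s in the reduced `j`-word of `λ` (`e = ∞`). -/
def phiInf {l : ℕ} (P : MP l) (s : Charge l) (j : ℤ) : ℤ :=
  sSup (insert 0 {z : ℤ | ∃ c0, z = prefInf P s j c0})

/-- The `sl∞`-weight `wt(λ,s)_∞ = Σ_j (φ^∞_j - ε^∞_j) Λ_j` of `(λ,s)`,
as a function giving the coordinate on each `Λ_j`. -/
def wtInf {l : ℕ} (P : MP l) (s : Charge l) : ℤ → ℤ :=
  fun j => phiInf P s j - epsInf P s j

/-- `#R - #A` on the suffix of the `i`-word (residues mod `e`) starting at the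
node of content `x0` in component `c0`. -/
def suffE {l : ℕ} (e : ℕ) (P : MP l) (s : Charge l) (i : ZMod e) (x0 : ℤ) (c0 : Fin l) : ℤ :=
  ∑ᶠ x : ℤ, if (x : ZMod e) = i then
      (if x0 < x then ∑ c : Fin l, (remR P s c x - addA P s c x)
       else if x = x0 then suffInf P s x c0 else 0)
    else 0

/-- `#A - #R` on the prefix of the `i`-word ending at the node of content `x0`
in component `c0`. -/
def prefE {l : ℕ} (e : ℕ) (P : MP l) (s : Charge l) (i : ZMod e) (x0 : ℤ) (c0 : Fin l) : ℤ :=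
  ∑ᶠ x : ℤ, if (x : ZMod e) = i then
      (if x < x0 then ∑ c : Fin l, (addA P s c x - remR P s c x)
       else if x = x0 then prefInf P s x c0 else 0)
    else 0

/-- `ε_i(λ)`: the number of `R`'s in the reduced `i`-word of `λ`, computed as the
largest value of `#R - #A` over suffixes of the `i`-word. -/
def epsE {l : ℕ} (e : ℕ) (P : MP l) (s : Charge l) (i : ZMod e) : ℤ :=
  sSup (insert 0 {z : ℤ | ∃ x0 c0, z = suffE e P s i x0 c0})

/-- `φ_i(λ)`: the number of `A`'s in the reduced `i`-word of `λ`. -/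
def phiE {l : ℕ} (e : ℕ) (P : MP l) (s : Charge l) (i : ZMod e) : ℤ :=
  sSup (insert 0 {z : ℤ | ∃ x0 c0, z = prefE e P s i x0 c0})

/-- The fundamental weight `Λ_{j0}` of `P_∞`, as a coordinate function. -/
def Lam (j0 : ℤ) : ℤ → ℤ := fun j => if j = j0 then 1 else 0

/-- The level-zero weight `ω_k = Λ_{k+1} - Λ_{k-e+1}`. -/
def omegaW (e : ℕ) (k : ℤ) : ℤ → ℤ := fun j => Lam (k + 1) j - Lam (k - (e : ℤ) + 1) j

/-- `Λ_{t,∞} = Λ_{t_0} + … + Λ_{t_{l-1}}`. -/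
def LamCh {l : ℕ} (t : Charge l) : ℤ → ℤ := fun j => ∑ c : Fin l, Lam (t c) j

/-- The node of content `x` in component `c` is the good addable `i`-node of `λ`:
it is addable, of residue `i`, and it is the leftmost node in the `i`-word at which
the prefix count `#A - #R` attains its maximum `φ_i(λ)` (equivalently it corresponds
to the rightmost `A` of the reduced `i`-word). -/
def IsGoodAddableE {l : ℕ} (e : ℕ) (P : MP l) (s : Charge l) (i : ZMod e)
    (x : ℤ) (c : Fin l) : Prop :=
  addA P s c x = 1 ∧ (x : ZMod e) = i ∧ prefE e P s i x c = phiE e P s i ∧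
  ∀ (x' : ℤ) (c' : Fin l), addA P s c' x' = 1 → (x' : ZMod e) = i →
    prefE e P s i x' c' = phiE e P s i → (x < x' ∨ (x = x' ∧ c' ≤ c))

/-- The node of content `x` in component `c` is the good addable `x`-node of `λ`
for the `e = ∞` structure. -/
def IsGoodAddableInf {l : ℕ} (P : MP l) (s : Charge l) (x : ℤ) (c : Fin l) : Prop :=
  addA P s c x = 1 ∧ prefInf P s x c = phiInf P s x ∧
  ∀ c' : Fin l, addA P s c' x = 1 → prefInf P s x c' = phiInf P s x → c' ≤ c

/-- One step of the `RA`-cancellation: the state is a reduced word `A^p R^q`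
(encoded `(p,q)`), and a new letter (`true` = `A`, `false` = `R`) is appended. -/
def reduceStep : ℕ × ℕ → Bool → ℕ × ℕ
  | (p, q), true => if q = 0 then (p + 1, 0) else (p, q - 1)
  | (p, q), false => (p, q + 1)

/-- The result `A^p R^q` of recursively deleting the factors `RA` in a word
(`true` = `A`, `false` = `R`). -/
def reduceRA (w : List Bool) : ℕ × ℕ := w.foldl reduceStep (0, 0)

/-- The word `u_j`: reading the entries `j` and `j+1` of the symbol, rows from
top to bottom, each row from right to left, encoding `j` by `A` and `j+1` by `R`. -/
def ujWord {l : ℕ} (P : MP l) (s : Charge l) (j : ℤ) : List Bool :=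
  ((List.finRange l).reverse.map (fun c =>
    (if RowHas P s c (j + 1) then [false] else []) ++
    (if RowHas P s c j then [true] else []))).flatten

/-- The word `u_i = u_{jlow} u_{jlow+e} u_{jlow+2e} ⋯` (truncated after `B` factors). -/
def uiWord {l : ℕ} (e : ℕ) (P : MP l) (s : Charge l) (jlow : ℤ) (B : ℕ) : List Bool :=
  ((List.range B).map (fun tt => ujWord P s (jlow + (tt : ℤ) * (e : ℤ)))).flatten

/-- `m` is admissible for the symbol of `(P,s)`: every row contains every integer `< m`. -/
def Admissible {l : ℕ} (P : MP l) (s : Charge l) (m : ℤ) : Prop :=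
  ∀ c, ∀ v : ℤ, v < m → RowHas P s c v

/-- The number of entries `≥ m` in row `c` of the symbol of `(P,s)`. -/
def nGE {l : ℕ} (P : MP l) (s : Charge l) (c : Fin l) (m : ℤ) : ℕ :=
  {i : ℕ | m ≤ symb P s c i}.ncard

/-- The symbol of `(P,s)` is semistandard: for every admissible `m` and every `j`,
the `j`-th smallest entry `≥ m` of row `c` is at least the `j`-th smallest entry
`≥ m` of row `c+1`, whenever both are defined. -/
def Semistandard {l : ℕ} (P : MP l) (s : Charge l) : Prop :=
  ∀ m : ℤ, Admissible P s m → ∀ c : Fin l, ∀ hc : (c : ℕ) + 1 < l, ∀ j : ℕ,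
    1 ≤ j → j ≤ nGE P s c m → j ≤ nGE P s ⟨(c : ℕ) + 1, hc⟩ m →
    symb P s ⟨(c : ℕ) + 1, hc⟩ (nGE P s ⟨(c : ℕ) + 1, hc⟩ m - j) ≤
      symb P s c (nGE P s c m - j)

/-- The box in row `c`, column `x`, belongs to the skew shape `u∖t`. -/
def InShape {l : ℕ} (u t : Charge l) (c : Fin l) (x : ℤ) : Prop := t c < x ∧ x ≤ u c

/-- `τ` is a skew (semistandard) tableau of shape `u∖t` (normalized by `0` outside
the shape): rows strictly increase from left to right, columns weakly increase
from top (row `l-1`) to bottom (row `0`). -/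
def IsSkewTableau {l : ℕ} (u t : Charge l) (τ : Fin l → ℤ → ℤ) : Prop :=
  (∀ c x, ¬ InShape u t c x → τ c x = 0) ∧
  (∀ c x, InShape u t c x → InShape u t c (x + 1) → τ c x < τ c (x + 1)) ∧
  (∀ (c : Fin l) (hc : (c : ℕ) + 1 < l) (x : ℤ),
    InShape u t c x → InShape u t ⟨(c : ℕ) + 1, hc⟩ x → τ ⟨(c : ℕ) + 1, hc⟩ x ≤ τ c x)

/-- The box `b` is read strictly before the box `b'` in the reading word of a skew
tableau (rows from top to bottom, right to left within each row). -/
def ReadBefore {l : ℕ} (b b' : Fin l × ℤ) : Prop :=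
  b'.1 < b.1 ∨ (b.1 = b'.1 ∧ b'.2 < b.2)

/-- `(M, q)` is the `e`-period of the skew tableau `τ` of shape `u∖t`:
`M` is the largest entry, `q k` is the last box in reading order with entry `M-k`,
and these boxes occur in increasing reading order. -/
def IsTabPeriod {l : ℕ} (e : ℕ) (u t : Charge l) (τ : Fin l → ℤ → ℤ) (M : ℤ)
    (q : Fin e → Fin l × ℤ) : Prop :=
  (∃ c x, InShape u t c x ∧ τ c x = M) ∧
  (∀ c x, InShape u t c x → τ c x ≤ M) ∧
  (∀ k : Fin e, InShape u t (q k).1 (q k).2 ∧ τ (q k).1 (q k).2 = M - ((k : ℕ) : ℤ) ∧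
    ∀ c x, InShape u t c x → τ c x = M - ((k : ℕ) : ℤ) → (c, x) ≠ q k →
      ReadBefore (c, x) (q k)) ∧
  ∀ (k : Fin e) (hk : (k : ℕ) + 1 < e), ReadBefore (q k) (q ⟨(k : ℕ) + 1, hk⟩)

/-- `(u',τ')` is obtained from the skew tableau `(u,τ)` (inner shape `t`) by deleting
the boxes of its `e`-period. -/
def TabDeletesTo {l : ℕ} (e : ℕ) (u t : Charge l) (τ : Fin l → ℤ → ℤ)
    (u' : Charge l) (τ' : Fin l → ℤ → ℤ) : Prop :=
  ∃ M q, IsTabPeriod e u t τ M q ∧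
    (∀ c : Fin l, u' c = u c - ((Finset.univ.filter (fun k : Fin e => (q k).1 = c)).card : ℤ)) ∧
    (∀ k : Fin e, u' (q k).1 < (q k).2) ∧
    τ' = fun c x => if InShape u' t c x then τ c x else 0

/-- The trivial tableau of shape `u∖t`: row `c` contains `t_c+1, …, u_c`. -/
def trivialTab {l : ℕ} (u t : Charge l) : Fin l → ℤ → ℤ :=
  fun c x => if InShape u t c x then x else 0

/-- The skew tableau `τ` of shape `u∖t` is totally `e`-periodic: iterated deletion of
`e`-periods (never stopping early at a trivial tableau with charge in `T_{l,e}`)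
empties the tableau. -/
def TabTotallyPeriodic {l : ℕ} (e : ℕ) (u t : Charge l) (τ : Fin l → ℤ → ℤ) : Prop :=
  ∃ (n : ℕ) (G : ℕ → Charge l × (Fin l → ℤ → ℤ)), G 0 = (u, τ) ∧
    (∀ m, m < n → ¬((G m).2 = trivialTab (G m).1 t ∧ (G m).1 ∈ Tle l e) ∧
      TabDeletesTo e (G m).1 t (G m).2 (G (m+1)).1 (G (m+1)).2) ∧
    (G n).1 = t

/-- The set `Tab^e_{u∖t}` of totally periodic skew tableaux of shape `u∖t`
(row `c` contains only integers `> t_c`). -/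
def TabSet {l : ℕ} (e : ℕ) (u t : Charge l) : Set (Fin l → ℤ → ℤ) :=
  {τ | IsSkewTableau u t τ ∧ (∀ c x, InShape u t c x → t c < τ c x) ∧
       TabTotallyPeriodic e u t τ}

/-- The `sl∞`-weight `wt(τ)_∞ = Σ_b ε_{τ(b)}` of a skew tableau, as a coordinate
function on the `Λ_j`. -/
def wtTab {l : ℕ} (u t : Charge l) (τ : Fin l → ℤ → ℤ) : ℤ → ℤ :=
  fun j => ({p : Fin l × ℤ | InShape u t p.1 p.2 ∧ τ p.1 p.2 = j - 1}.ncard : ℤ)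
         - ({p : Fin l × ℤ | InShape u t p.1 p.2 ∧ τ p.1 p.2 = j}.ncard : ℤ)

/-- `Tab^e_{u∖t,γ}`: totally periodic skew tableaux of shape `u∖t` and weight `γ`. -/
def TabSetWt {l : ℕ} (e : ℕ) (u t : Charge l) (γ : ℤ → ℤ) : Set (Fin l → ℤ → ℤ) :=
  {τ ∈ TabSet e u t | wtTab u t τ = γ}

/-- The level-`0` part `B(λ,s)_0` of a symbol: the skew tableau of shape `s∖t`
whose row `c` lists, in increasing order, the entries `> t_c` of row `c` of the
symbol of `(P,s)` (these are the entries deleted during the peeling when `s° = t`). -/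
def level0 {l : ℕ} (P : MP l) (s t : Charge l) : Fin l → ℤ → ℤ :=
  fun c x =>
    if t c < x ∧ x ≤ s c then
      sInf {u : ℤ | RowHas P s c u ∧ t c < u ∧
        ({v : ℤ | RowHas P s c v ∧ t c < v ∧ v ≤ u}.ncard : ℤ) = x - t c}
    else 0

/-- The Young diagram `λ(v)`: the conjugate of the partition
`(v_{l-1}-v_0, v_{l-2}-v_0, …, v_1-v_0)`, as a set of boxes `(row, column)`. -/
def lamShape {l : ℕ} (hl : 0 < l) (v : Charge l) : Set (ℕ × ℕ) :=
  {rc | rc.2 + 1 < l ∧ (rc.1 : ℤ) < v ⟨l - 1 - rc.2, by omega⟩ - v ⟨0, hl⟩}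

/-- The set of semistandard Young tableaux of shape `λ(v)` and weight
`μ(v) = (s_0 - v_0, …, s_{l-1} - v_0)`; its cardinality is the Kostka number
`K_{λ(v),μ(v)}`. -/
def KostkaSet {l : ℕ} (hl : 0 < l) (v s : Charge l) : Set (ℕ → ℕ → ℕ) :=
  {T | (∀ r c, (r, c) ∉ lamShape hl v → T r c = 0) ∧
       (∀ r c, (r, c) ∈ lamShape hl v → 1 ≤ T r c ∧ T r c ≤ l) ∧
       (∀ r c, (r, c) ∈ lamShape hl v → (r, c + 1) ∈ lamShape hl v → T r c ≤ T r (c + 1)) ∧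
       (∀ r c, (r, c) ∈ lamShape hl v → (r + 1, c) ∈ lamShape hl v → T r c < T (r + 1) c) ∧
       ∀ cc : Fin l,
         (({rc : ℕ × ℕ | rc ∈ lamShape hl v ∧ T rc.1 rc.2 = (cc : ℕ) + 1}.ncard : ℤ))
           = s cc - v ⟨0, hl⟩}

/-- `w` is a reverse lattice (Yamanouchi) word: it can be decomposed into disjoint
subwords of the form `a (a-1) (a-2) ⋯ min(w)`. -/
def IsReverseLatticeWord (w : List ℤ) : Prop :=
  w = [] ∨ ∃ mn : ℤ, mn ∈ w ∧ (∀ x ∈ w, mn ≤ x) ∧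
    ∃ (r : ℕ) (col : Fin w.length → Fin r) (a : Fin r → ℤ),
      (∀ p : Fin w.length,
        w.get p = a (col p) -
          ((Finset.univ.filter (fun q : Fin w.length => q < p ∧ col q = col p)).card : ℤ)) ∧
      ∀ jj : Fin r,
        ((Finset.univ.filter (fun p : Fin w.length => col p = jj)).card : ℤ) = a jj - mn + 1

/-- The word obtained by reading the entries `≥ m` of the symbol of `(P,s)`,
rows from top to bottom, each row from right to left (i.e. in decreasing order). -/
def readWordGE {l : ℕ} (P : MP l) (s : Charge l) (m : ℤ) : List ℤ :=
  ((List.finRange l).reverse.map (fun c =>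
     (List.range (nGE P s c m)).map (fun i => symb P s c i))).flatten


theorem symb_strictAnti {l : ℕ} {P : MP l} (hP : IsLPartition P) (s : Charge l) (c : Fin l) :
    StrictAnti (symb P s c) := by
  intro i j hij
  have := hP.1 c hij.le
  simp only [symb]
  omega

theorem exists_symb_lt {l : ℕ} {P : MP l} (hP : IsLPartition P) (s : Charge l) (c : Fin l)
    (m : ℤ) : ∃ i, symb P s c i < m := by
  refine ⟨(P c 0 + s c - m).toNat + 1, ?_⟩
  have := hP.1 c (Nat.zero_le ((P c 0 + s c - m).toNat + 1))
  simp only [symb]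
  omega

theorem le_symb_iff {l : ℕ} {P : MP l} (hP : IsLPartition P) (s : Charge l) (c : Fin l)
    (m : ℤ) (i : ℕ) : m ≤ symb P s c i ↔ i < nGE P s c m := by
  have key : ∀ i, m ≤ symb P s c i ↔ i < Nat.find (exists_symb_lt hP s c m) := by
    intro i
    rw [Nat.lt_find_iff]
    constructor
    · intro h j hj
      have := (symb_strictAnti hP s c).antitone hj
      omega
    · intro h
      exact not_lt.1 (h i le_rfl)
  have : nGE P s c m = Nat.find (exists_symb_lt hP s c m) := by
    simp only [nGE, key]
    exact (congrArg Set.ncard (Finset.coe_range _)).symm.trans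
      ((Set.ncard_coe_finset _).trans (Finset.card_range _))
  rw [this, key]

/-- The deleted entries of each row are its largest ones. -/
theorem DeletesTo.exists_symb_eq_add {l e : ℕ} {P P' : MP l} {s s' : Charge l}
    (hP : IsLPartition P) (h : DeletesTo e P s P' s') (d : Fin l) :
    ∃ r, ∀ i, symb P' s' d i = symb P s d (i + r) := by
  obtain ⟨k, per, ⟨⟨-, hmax⟩, hanti, hper⟩, hP', hrow⟩ := h
  have hupper : ∀ v w : ℤ, RowHas P s d w → v ≤ w →
      (∃ t : Fin e, per t = d ∧ v = k - ((t : ℕ) : ℤ)) →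
      ∃ t : Fin e, per t = d ∧ w = k - ((t : ℕ) : ℤ) := by
    rintro v w hw hvw ⟨t, rfl, rfl⟩
    have hwk := hmax _ _ hw
    have ht := t.2
    let t' : Fin e := ⟨(k - w).toNat, by omega⟩
    have hwt : w = k - ((t' : ℕ) : ℤ) := by simp only [t']; omega
    have htt : t' ≤ t := by
      rw [Fin.le_def]; simp only [t']; omega
    exact ⟨t', le_antisymm ((hper t').2 _ (hwt ▸ hw)) (hanti htt), hwt⟩
  have hex : ∃ i, ¬ ∃ t : Fin e, per t = d ∧ symb P s d i = k - ((t : ℕ) : ℤ) := by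
    obtain ⟨i, hi⟩ := exists_symb_lt hP s d (k - e)
    refine ⟨i, ?_⟩
    rintro ⟨t, -, ht⟩
    have := t.2
    omega
  refine ⟨Nat.find hex, fun i => ?_⟩
  have hmono : StrictMono fun i => -symb P' s' d i :=
    fun _ _ hij => neg_lt_neg (symb_strictAnti hP' s' d hij)
  have hmono' : StrictMono fun i => -symb P s d (i + Nat.find hex) :=
    fun _ _ hij => neg_lt_neg (symb_strictAnti hP s d (by omega))
  refine neg_injective (congrFun ((hmono.range_inj hmono').1 ?_) i)
  ext v
  have hv := Set.ext_iff.1 (hrow d) (-v)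
  simp only [Set.mem_ofPred_eq, Set.mem_sdiff] at hv
  have hneg : ∀ f : ℕ → ℤ, v ∈ Set.range (fun i => -f i) ↔ ∃ i, f i = -v := fun f => by
    simp only [Set.mem_range, neg_eq_iff_eq_neg]
  rw [hneg, hneg fun i => symb P s d (i + Nat.find hex)]
  refine hv.trans ⟨?_, ?_⟩
  · rintro ⟨⟨j, hj⟩, hn⟩
    have hle : Nat.find hex ≤ j := Nat.find_min' hex (by rwa [hj])
    exact ⟨j - Nat.find hex, by rw [Nat.sub_add_cancel hle, hj]⟩
  · rintro ⟨j, hj⟩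
    refine ⟨⟨_, hj⟩, fun hn => Nat.find_spec hex ?_⟩
    exact hupper _ _ ⟨_, rfl⟩
      (hj ▸ (symb_strictAnti hP s d).antitone (Nat.le_add_left _ _)) hn

theorem Semistandard.deletesTo {l e : ℕ} {P P' : MP l} {s s' : Charge l}
    (hss : Semistandard P s) (hP : IsLPartition P) (h : DeletesTo e P s P' s') :
    Semistandard P' s' := by
  have hP' : IsLPartition P' := by
    obtain ⟨_, _, _, hP', _⟩ := h
    exact hP'
  choose r hr using h.exists_symb_eq_add hP
  intro m hm c hc j hj h1 h2
  have hadm : Admissible P s m := fun d v hv => by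
    obtain ⟨i, hi⟩ := hm d v hv
    exact ⟨i + r d, by rw [← hr, hi]⟩
  have hn : ∀ d i, i < nGE P' s' d m ↔ i + r d < nGE P s d m := fun d i => by
    rw [← le_symb_iff hP', ← le_symb_iff hP, hr]
  have hsum : ∀ d, j ≤ nGE P' s' d m → nGE P' s' d m + r d = nGE P s d m := fun d hd => by
    have a := hn d (nGE P' s' d m)
    have b := hn d (nGE P' s' d m - 1)
    omega
  have e1 := hsum _ h1
  have e2 := hsum _ h2
  have := hss m hadm c hc j hj (by omega) (by omega)
  rw [hr, hr]
  convert this using 2 <;> omega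

/-- semistandardness is preserved along the peeling procedure:
every symbol obtained from a semistandard symbol by successively deleting
`e`-periods is again semistandard. -/
theorem semistandard_of_peeling {l e : ℕ} (hl : 0 < l) (he : 2 ≤ e)
    (P : MP l) (s : Charge l) (hP : IsLPartition P) (hss : Semistandard P s)
    (n : ℕ) (g : ℕ → MP l × Charge l) (hg0 : g 0 = (P, s))
    (hstep : ∀ m, m < n → DeletesTo e (g m).1 (g m).2 (g (m + 1)).1 (g (m + 1)).2) :
    ∀ m, m ≤ n → Semistandard (g m).1 (g m).2 := by
  have key : ∀ m, m ≤ n → IsLPartition (g m).1 ∧ Semistandard (g m).1 (g m).2 := by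
    intro m
    induction m with
    | zero => intro _; rw [hg0]; exact ⟨hP, hss⟩
    | succ m ih =>
      intro hm
      obtain ⟨h1, h2⟩ := ih (by omega)
      have h := hstep m (by omega)
      refine ⟨?_, h2.deletesTo h1 h⟩
      obtain ⟨_, _, _, hP', _⟩ := h
      exact hP'
  exact fun m hm => (key m hm).2

end FockHW
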